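/- Let R̂ be an invertible operator on V⊗V satisfying the Yang–Baxter equation. Fix k, i ≥ 1 and set U := R̂_{i→i+k−1} ⋯ R̂_{2→k+1} R̂_{1→k}, where R̂_{j→m} := R̂_j R̂_{j+1} ⋯ R̂_m. Then for any polynomial Y^{(k)} in R̂₁,…,R̂_{k−1} and any polynomial Z^{(i)} in R̂₁,…,R̂_{i−1}, one has U · Y^{(k)}(R̂₁,…,R̂_{k−1}) = Y^{(k)}(R̂_{i+1},…,R̂_{i+k−1}) · U and U · Z^{(i)}(R̂_{k+1},…,R̂_{k+i−1}) = Z^{(i)}(R̂₁,…,R̂_{i−1}) · U, as operators on V^{⊗(k+i)}. -/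

import Mathlib

/-! Common definitions for quantum matrix algebras `M(R̂,F̂)` in the sense of
Isaev–Ogievetsky–Pyatov, "On quantum matrix algebras satisfying the
Cayley-Hamilton-Newton identities".

We model operators on `V^{⊗m}` (where `dim V = N`) as matrices indexed by
multi-indices `Fin m → Fin N`; entries are taken in a (possibly
noncommutative) unital associative algebra `A` over a field `K`.
Sites (tensor factors) are numbered starting from `0`, so the paper's
`X_i` is `site m (i-1) X`, and the paper's `M_{\overline{k}}` is
`Mbar m F F⁻¹ M (k-1)`. -/

namespace CHN

noncomputable section

/-- Operators on `V^{⊗m}` (`dim V = N`) with entries in a ring `A`. -/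
abbrev Op (N : ℕ) (A : Type*) [Ring A] (m : ℕ) :=
  Matrix (Fin m → Fin N) (Fin m → Fin N) A

/-- Operators on `V ⊗ V`. -/
abbrev M2 (N : ℕ) (A : Type*) [Ring A] :=
  Matrix (Fin N × Fin N) (Fin N × Fin N) A

/-- `site m i X` places the two-site operator `X` at the (0-based) tensor
factors `i, i+1` of `V^{⊗m}`, acting as the identity elsewhere.  In the
paper's 1-based notation, `X_i = site m (i-1) X`.  (Out of range it is the
identity.) -/
def site {A : Type*} [Ring A] {N : ℕ} (m i : ℕ) (X : M2 N A) : Op N A m :=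
  fun a b =>
    if h : i + 1 < m then
      X (a ⟨i, Nat.lt_of_succ_lt h⟩, a ⟨i + 1, h⟩)
          (b ⟨i, Nat.lt_of_succ_lt h⟩, b ⟨i + 1, h⟩) *
        (if ∀ j : Fin m, (j : ℕ) ≠ i → (j : ℕ) ≠ i + 1 → a j = b j then 1 else 0)
    else if a = b then 1 else 0

/-- `site1 m i X` places the one-site operator `X` at the (0-based) factor `i`. -/
def site1 {A : Type*} [Ring A] {N : ℕ} (m i : ℕ) (X : Matrix (Fin N) (Fin N) A) :
    Op N A m :=
  fun a b =>
    if h : i < m then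
      X (a ⟨i, h⟩) (b ⟨i, h⟩) *
        (if ∀ j : Fin m, (j : ℕ) ≠ i → a j = b j then 1 else 0)
    else if a = b then 1 else 0

/-- `chain m X i l = X_i X_{i+1} ⋯ X_{i+l-1}` (0-based sites, `l` factors); in
the paper's 1-based notation this is `X_{i+1 → i+l}`. -/
def chain {A : Type*} [Ring A] {N : ℕ} (m : ℕ) (X : M2 N A) (i : ℕ) :
    ℕ → Op N A m
  | 0 => 1
  | l + 1 => chain m X i l * site m (i + l) X

/-- The Yang–Baxter equation `X₁X₂X₁ = X₂X₁X₂` on `V^{⊗3}`. -/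
def YB {A : Type*} [Ring A] {N : ℕ} (X : M2 N A) : Prop :=
  site 3 0 X * site 3 1 X * site 3 0 X = site 3 1 X * site 3 0 X * site 3 1 X

/-- Compatibility of a pair of R-matrices: both Yang–Baxter equations together
with the conditions `R̂₁F̂₂F̂₁ = F̂₂F̂₁R̂₂` and `F̂₁F̂₂R̂₁ = R̂₂F̂₁F̂₂` on `V^{⊗3}`. -/
def Compatible {A : Type*} [Ring A] {N : ℕ} (R F : M2 N A) : Prop :=
  YB R ∧ YB F ∧
    site 3 0 R * site 3 1 F * site 3 0 F = site 3 1 F * site 3 0 F * site 3 1 R ∧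
    site 3 0 F * site 3 1 F * site 3 0 R = site 3 1 R * site 3 0 F * site 3 1 F

/-- `Ψ` witnesses closedness of `F̂`:  `Ψ^{af}_{cg} F̂^{gb}_{fd} = δ^a_d δ^b_c`. -/
def IsClosedPair {A : Type*} [Ring A] {N : ℕ} (F Ψ : M2 N A) : Prop :=
  ∀ a b c d : Fin N,
    (∑ f : Fin N, ∑ g : Fin N, Ψ (a, f) (c, g) * F (g, b) (f, d)) =
      if a = d ∧ b = c then 1 else 0

/-- The matrix `D`, `D^a_b := Ψ^{ac}_{bc}`. -/
def Dmat {A : Type*} [Ring A] {N : ℕ} (Ψ : M2 N A) : Matrix (Fin N) (Fin N) A :=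
  fun a b => ∑ c : Fin N, Ψ (a, c) (b, c)

/-- Quantum trace (with weight `D`) over the last tensor factor. -/
def qtr1 {K : Type*} [Field K] {A : Type*} [Ring A] [Algebra K A] {N m : ℕ}
    (D : Matrix (Fin N) (Fin N) K) (X : Op N A (m + 1)) : Op N A m :=
  fun a b => ∑ c : Fin N, ∑ e : Fin N,
    algebraMap K A (D c e) * X (Fin.snoc a e) (Fin.snoc b c)

/-- Quantum trace over the last `j` tensor factors. -/
def qtrs {K : Type*} [Field K] {A : Type*} [Ring A] [Algebra K A] {N : ℕ}
    (D : Matrix (Fin N) (Fin N) K) (m : ℕ) :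
    (j : ℕ) → Op N A (m + j) → Op N A m
  | 0, X => X
  | j + 1, X => qtrs D m j (qtr1 D X)

/-- Full quantum trace `Tr_F(1,…,m)`, with values in `A`. -/
def qtrAll {K : Type*} [Field K] {A : Type*} [Ring A] [Algebra K A] {N m : ℕ}
    (D : Matrix (Fin N) (Fin N) K) (X : Op N A m) : A :=
  ∑ a : Fin m → Fin N, ∑ b : Fin m → Fin N,
    algebraMap K A (∏ i, D (a i) (b i)) * X b a

/-- Quantum trace of a one-site operator:  `Tr_F X = Tr (D X)`. -/
def trF {K : Type*} [Field K] {A : Type*} [Ring A] [Algebra K A] {N : ℕ}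
    (D : Matrix (Fin N) (Fin N) K) (X : Matrix (Fin N) (Fin N) A) : A :=
  ∑ a : Fin N, ∑ b : Fin N, algebraMap K A (D a b) * X b a

/-- Ordinary partial trace over the last tensor factor. -/
def ptr1 {A : Type*} [Ring A] {N m : ℕ} (X : Op N A (m + 1)) : Op N A m :=
  fun a b => ∑ c : Fin N, X (Fin.snoc a c) (Fin.snoc b c)

/-- Ordinary partial trace over the last `j` tensor factors. -/
def ptrs {A : Type*} [Ring A] {N : ℕ} (m : ℕ) :
    (j : ℕ) → Op N A (m + j) → Op N A m
  | 0, X => X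
  | j + 1, X => ptrs m j (ptr1 X)

/-- `Mbar m F Finv M k` is the paper's `M_{\overline{k+1}}` (0-based index `k`):
`M_{\overline{1}} := M₁` and `M_{\overline{k+1}} := F̂_k M_{\overline{k}} F̂_k⁻¹`. -/
def Mbar {A : Type*} [Ring A] {N : ℕ} (m : ℕ) (F Finv : M2 N A)
    (M : Matrix (Fin N) (Fin N) A) : ℕ → Op N A m
  | 0 => site1 m 0 M
  | k + 1 => site m k F * Mbar m F Finv M k * site m k Finv

/-- `MbarSeg m F Finv M i l = M_{\overline{i+1}} M_{\overline{i+2}} ⋯ M_{\overline{i+l}}`,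
the ordered product of `l` consecutive copies starting at 0-based index `i`.
In particular `MbarSeg m F Finv M 0 k = M_{\overline{1}} ⋯ M_{\overline{k}}`. -/
def MbarSeg {A : Type*} [Ring A] {N : ℕ} (m : ℕ) (F Finv : M2 N A)
    (M : Matrix (Fin N) (Fin N) A) (i : ℕ) : ℕ → Op N A m
  | 0 => 1
  | l + 1 => MbarSeg m F Finv M i l * Mbar m F Finv M (i + l)

/-- The double twist `R̂^{FF} = F̂ (F̂ R̂ F̂⁻¹) F̂⁻¹`. -/
def RFF {K : Type*} [Field K] {N : ℕ} (R F : M2 N K) : M2 N K :=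
  F * (F * R * F⁻¹) * F⁻¹

/-- `M` is a matrix of generators of the algebra `M(R̂,F̂)`:
`R̂₁ M_{\overline{1}} M_{\overline{2}} = M_{\overline{1}} M_{\overline{2}} (R̂^{FF})₁`
on `V ⊗ V`. -/
def IsGenerators {K : Type*} [Field K] {A : Type*} [Ring A] [Algebra K A] {N : ℕ}
    (R F : M2 N K) (M : Matrix (Fin N) (Fin N) A) : Prop :=
  site 2 0 (R.map (algebraMap K A)) *
      MbarSeg 2 (F.map (algebraMap K A)) ((F⁻¹).map (algebraMap K A)) M 0 2 =
    MbarSeg 2 (F.map (algebraMap K A)) ((F⁻¹).map (algebraMap K A)) M 0 2 *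
      site 2 0 ((RFF R F).map (algebraMap K A))

/-- Evaluation of a noncommutative polynomial `Y` in `v` variables, substituting
for the variable `x_j` the operator `R̂` placed at the (0-based) sites
`p+j, p+j+1` of `V^{⊗m}`.  For `p = 0` this is the paper's
`Y^{(v+1)} = Y^{(v+1)}(R̂₁,…,R̂_v)`, and a general `p` gives `Y^{(p+1,v+1)}`. -/
def evalY {K : Type*} [Field K] {A : Type*} [Ring A] [Algebra K A] {N m v : ℕ}
    (R : M2 N A) (p : ℕ) (Y : FreeAlgebra K (Fin v)) : Op N A m :=
  FreeAlgebra.lift K (fun j : Fin v => site m (p + (j : ℕ)) R) Y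

/-- `Ustack m R k l = R̂_{l → l+k-1} ⋯ R̂_{2 → k+1} R̂_{1 → k}` (1-based labels):
the product of `l` descending chains of length `k`. -/
def Ustack {A : Type*} [Ring A] {N : ℕ} (m : ℕ) (R : M2 N A) (k : ℕ) :
    ℕ → Op N A m
  | 0 => 1
  | l + 1 => chain m R l k * Ustack m R k l

/-- The `q`-number `n_q = (qⁿ − q⁻ⁿ)/(q − q⁻¹)`. -/
def qInt {K : Type*} [Field K] (q : K) (n : ℕ) : K :=
  (q ^ n - q⁻¹ ^ n) / (q - q⁻¹)

/-- `R̂` is a Hecke R-matrix for the parameter `q`:  it is invertible, satisfies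
the Yang–Baxter equation and the Hecke condition `R̂² = 1 + (q − q⁻¹)R̂`. -/
def IsHecke {K : Type*} [Field K] {N : ℕ} (q : K) (R : M2 N K) : Prop :=
  IsUnit R ∧ YB R ∧ R * R = 1 + (q - q⁻¹) • R

/-- The `q`-antisymmetrizer `A^{(k)}` built from `R̂`, placed at the (0-based)
tensor factors `p, p+1, …, p+k-1` of `V^{⊗m}`. -/
def qasym {K : Type*} [Field K] {N : ℕ} (q : K) (R : M2 N K) (m p : ℕ) :
    ℕ → Op N K m
  | 0 => 1
  | 1 => 1
  | k + 2 =>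
      (qInt q (k + 2))⁻¹ •
        (qasym q R m p (k + 1) *
          (q ^ (k + 1) • (1 : Op N K m) - qInt q (k + 1) • site m (p + k) R) *
          qasym q R m p (k + 1))

/-- The `q`-symmetrizer `S^{(k)}` built from `R̂`, placed at the (0-based)
tensor factors `p, p+1, …, p+k-1` of `V^{⊗m}`. -/
def qsym {K : Type*} [Field K] {N : ℕ} (q : K) (R : M2 N K) (m p : ℕ) :
    ℕ → Op N K m
  | 0 => 1
  | 1 => 1
  | k + 2 =>
      (qInt q (k + 2))⁻¹ •
        (qsym q R m p (k + 1) *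
          (q⁻¹ ^ (k + 1) • (1 : Op N K m) + qInt q (k + 1) • site m (p + k) R) *
          qsym q R m p (k + 1))

/-- The elementary symmetric function
`σ_k(M) = Tr_F(1,…,k)(A^{(k)} M_{\overline{1}}⋯M_{\overline{k}})` (with `σ_0 = 1`). -/
def sigmaF {K : Type*} [Field K] {A : Type*} [Ring A] [Algebra K A] {N : ℕ}
    (q : K) (R F Ψ : M2 N K) (M : Matrix (Fin N) (Fin N) A) (k : ℕ) : A :=
  qtrAll (Dmat Ψ)
    ((qasym q R k 0 k).map (algebraMap K A) *
      MbarSeg k (F.map (algebraMap K A)) ((F⁻¹).map (algebraMap K A)) M 0 k)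

/-- The complete symmetric function
`τ_k(M) = Tr_F(1,…,k)(S^{(k)} M_{\overline{1}}⋯M_{\overline{k}})` (with `τ_0 = 1`). -/
def tauF {K : Type*} [Field K] {A : Type*} [Ring A] [Algebra K A] {N : ℕ}
    (q : K) (R F Ψ : M2 N K) (M : Matrix (Fin N) (Fin N) A) (k : ℕ) : A :=
  qtrAll (Dmat Ψ)
    ((qsym q R k 0 k).map (algebraMap K A) *
      MbarSeg k (F.map (algebraMap K A)) ((F⁻¹).map (algebraMap K A)) M 0 k)

/-- The power sums `s_k(M) = Tr_F(1,…,k)(R̂_{1→k−1} M_{\overline{1}}⋯M_{\overline{k}})`,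
with `s_0 = 1`. -/
def sF {K : Type*} [Field K] {A : Type*} [Ring A] [Algebra K A] {N : ℕ}
    (R F Ψ : M2 N K) (M : Matrix (Fin N) (Fin N) A) : ℕ → A
  | 0 => 1
  | j + 1 =>
      qtrAll (Dmat Ψ)
        (chain (j + 1) (R.map (algebraMap K A)) 0 j *
          MbarSeg (j + 1) (F.map (algebraMap K A)) ((F⁻¹).map (algebraMap K A)) M 0 (j + 1))

/-- The `(j+1)`-st quantum power of `M`,
`M^{\overline{j+1}} = Tr_F(2,…,j+1)(R̂_{1→j} M_{\overline{1}}⋯M_{\overline{j+1}})`,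
as a one-site operator (so `MpowF R F Ψ M 0 = M₁ = M`). -/
def MpowF {K : Type*} [Field K] {A : Type*} [Ring A] [Algebra K A] {N : ℕ}
    (R F Ψ : M2 N K) (M : Matrix (Fin N) (Fin N) A) (j : ℕ) : Op N A 1 :=
  qtrs (Dmat Ψ) 1 j
    (chain (1 + j) (R.map (algebraMap K A)) 0 j *
      MbarSeg (1 + j) (F.map (algebraMap K A)) ((F⁻¹).map (algebraMap K A)) M 0 (j + 1))

/-- The `(j+1)`-st wedge power of `M`,
`M^{∧(j+1)} = Tr_F(2,…,j+1)(A^{(j+1)} M_{\overline{1}}⋯M_{\overline{j+1}})`. -/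
def MwedgeF {K : Type*} [Field K] {A : Type*} [Ring A] [Algebra K A] {N : ℕ}
    (q : K) (R F Ψ : M2 N K) (M : Matrix (Fin N) (Fin N) A) (j : ℕ) : Op N A 1 :=
  qtrs (Dmat Ψ) 1 j
    ((qasym q R (1 + j) 0 (j + 1)).map (algebraMap K A) *
      MbarSeg (1 + j) (F.map (algebraMap K A)) ((F⁻¹).map (algebraMap K A)) M 0 (j + 1))

/-- The `(j+1)`-st symmetric power of `M`,
`M^{S(j+1)} = Tr_F(2,…,j+1)(S^{(j+1)} M_{\overline{1}}⋯M_{\overline{j+1}})`. -/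
def MsymF {K : Type*} [Field K] {A : Type*} [Ring A] [Algebra K A] {N : ℕ}
    (q : K) (R F Ψ : M2 N K) (M : Matrix (Fin N) (Fin N) A) (j : ℕ) : Op N A 1 :=
  qtrs (Dmat Ψ) 1 j
    ((qsym q R (1 + j) 0 (j + 1)).map (algebraMap K A) *
      MbarSeg (1 + j) (F.map (algebraMap K A)) ((F⁻¹).map (algebraMap K A)) M 0 (j + 1))

/-- `M^{\overline{0}} := q^{-n} n_q Tr_{(2,…,n)}(A^{(n)}) D^{-1}`, with `n = n0 + 1`
(an ordinary, non-quantum, trace over the factors `2,…,n`). -/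
def MzeroF {K : Type*} [Field K] {N : ℕ} (q : K) (R Ψ : M2 N K) (n0 : ℕ) :
    Op N K 1 :=
  (q⁻¹ ^ (n0 + 1) * qInt q (n0 + 1)) •
    (ptrs 1 n0 (qasym q R (1 + n0) 0 (n0 + 1)) * site1 1 0 ((Dmat Ψ)⁻¹))

/-- The generators of the characteristic subalgebra: all elements
`α(Y^{(k)}) = Tr_F(1,…,k)(Y^{(k)} M_{\overline{1}}⋯M_{\overline{k}})`, `k ≥ 1`. -/
def charSet {K : Type*} [Field K] {A : Type*} [Ring A] [Algebra K A] {N : ℕ}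
    (R F Ψ : M2 N K) (M : Matrix (Fin N) (Fin N) A) : Set A :=
  { x : A | ∃ (v : ℕ) (Y : FreeAlgebra K (Fin v)),
      x = qtrAll (Dmat Ψ)
        (evalY (R.map (algebraMap K A)) 0 Y *
          MbarSeg (v + 1) (F.map (algebraMap K A)) ((F⁻¹).map (algebraMap K A)) M 0 (v + 1)) }

end

/-- The operator `X` on `V^{⊗r}` placed at the tensor factors `f 0, …, f (r-1)` of `V^{⊗m}`,
acting as the identity on the other factors. -/
def place {A : Type*} [Ring A] {N r m : ℕ} (f : Fin r → Fin m) (X : Op N A r) : Op N A m :=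
  fun a b => X (a ∘ f) (b ∘ f) * if ∀ j, (∀ t, f t ≠ j) → a j = b j then 1 else 0

theorem place_mul {A : Type*} [Ring A] {N r m : ℕ} {f : Fin r → Fin m}
    (hf : Function.Injective f) (X Y : Op N A r) :
    place f (X * Y) = place f X * place f Y := by
  ext a b
  simp only [place, Matrix.mul_apply]
  rw [Finset.sum_mul]
  refine Fintype.sum_of_injective (fun d => Function.extend f d a) ?_ _ _ ?_ ?_
  · intro d d' h
    funext t
    simpa [hf.extend_apply] using congrFun h (f t)
  · intro c hc
    rw [if_neg, mul_zero, zero_mul]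
    refine fun h => hc ⟨c ∘ f, funext fun j => ?_⟩
    by_cases hj : ∃ t, f t = j
    · obtain ⟨t, rfl⟩ := hj
      simp [hf.extend_apply]
    · simp only [Function.extend_apply' _ _ _ hj]
      exact h j (not_exists.mp hj)
  · intro d
    have hoff (j : Fin m) (hj : ∀ t, f t ≠ j) : Function.extend f d a j = a j :=
      Function.extend_apply' _ _ _ (not_exists.mpr hj)
    have hon : Function.extend f d a ∘ f = d := funext fun t => hf.extend_apply d a t
    have hiff : (∀ j, (∀ t, f t ≠ j) → Function.extend f d a j = b j) ↔
        ∀ j, (∀ t, f t ≠ j) → a j = b j :=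
      forall₂_congr fun j hj => by rw [hoff j hj]
    rw [hon, if_pos fun j hj => (hoff j hj).symm, mul_one]
    simp only [hiff, mul_assoc]

theorem place_mul_place_apply {A : Type*} [Ring A] {N r r' m : ℕ} {f : Fin r → Fin m}
    {g : Fin r' → Fin m} (hf : Function.Injective f) (hfg : ∀ t u, f t ≠ g u)
    (X : Op N A r) (Y : Op N A r') (a b : Fin m → Fin N) :
    (place f X * place g Y) a b = X (a ∘ f) (b ∘ f) * Y (a ∘ g) (b ∘ g) *
      if ∀ j, (∀ t, f t ≠ j) → (∀ u, g u ≠ j) → a j = b j then 1 else 0 := by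
  have hon : Function.extend f (b ∘ f) a ∘ f = b ∘ f :=
    funext fun t => hf.extend_apply _ a t
  have hoff (j : Fin m) (hj : ∀ t, f t ≠ j) : Function.extend f (b ∘ f) a j = a j :=
    Function.extend_apply' _ _ _ (not_exists.mpr hj)
  have hg : Function.extend f (b ∘ f) a ∘ g = a ∘ g :=
    funext fun u => hoff _ fun t => hfg t u
  have hiff : (∀ j, (∀ u, g u ≠ j) → Function.extend f (b ∘ f) a j = b j) ↔
      ∀ j, (∀ t, f t ≠ j) → (∀ u, g u ≠ j) → a j = b j := by
    refine forall_congr' fun j => ⟨fun h hj hu => hoff j hj ▸ h hu, fun h hu => ?_⟩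
    by_cases hj : ∃ t, f t = j
    · obtain ⟨t, rfl⟩ := hj
      exact hf.extend_apply _ a t
    · rw [hoff j (not_exists.mp hj)]
      exact h (not_exists.mp hj) hu
  rw [Matrix.mul_apply, Finset.sum_eq_single (Function.extend f (b ∘ f) a)]
  · simp only [place, hon, hg, hiff]
    rw [if_pos fun j hj => (hoff j hj).symm, mul_one, mul_assoc]
  · intro c _ hc
    simp only [place]
    by_cases h₁ : ∀ j, (∀ t, f t ≠ j) → a j = c j
    · rw [if_neg (c := ∀ j, (∀ u, g u ≠ j) → c j = b j), mul_zero, mul_zero]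
      refine fun h₂ => hc (funext fun j => ?_)
      by_cases hj : ∃ t, f t = j
      · obtain ⟨t, rfl⟩ := hj
        rw [hf.extend_apply]
        exact h₂ _ fun u => (hfg t u).symm
      · rw [hoff j (not_exists.mp hj)]
        exact (h₁ j (not_exists.mp hj)).symm
    · rw [if_neg h₁, mul_zero, zero_mul]
  · exact fun h => absurd (Finset.mem_univ _) h

theorem commute_place {A : Type*} [CommRing A] {N r r' m : ℕ} {f : Fin r → Fin m}
    {g : Fin r' → Fin m} (hf : Function.Injective f) (hg : Function.Injective g)
    (hfg : ∀ t u, f t ≠ g u) (X : Op N A r) (Y : Op N A r') :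
    Commute (place f X) (place g Y) := by
  ext a b
  rw [place_mul_place_apply hf hfg, place_mul_place_apply hg fun u t => (hfg t u).symm,
    mul_comm (X _ _)]
  congr 2
  exact propext (forall_congr' fun j => forall_comm)

/-- The inclusion of `n` consecutive tensor factors, starting with the `i`-th one. -/
def window {n m : ℕ} (i : ℕ) (h : i + n ≤ m) (t : Fin n) : Fin m :=
  ⟨i + t, by omega⟩

theorem window_injective {n m : ℕ} (i : ℕ) (h : i + n ≤ m) :
    Function.Injective (window i h) := by
  intro t u htu
  simpa [window, Fin.ext_iff] using htu

theorem site_add {A : Type*} [Ring A] {N n m : ℕ} (i j : ℕ) (h : i + n ≤ m) (hj : j + 1 < n)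
    (X : M2 N A) : site m (i + j) X = place (window i h) (site n j X) := by
  ext a b
  have hm : i + j + 1 < m := by omega
  simp only [site, place, dif_pos hm, dif_pos hj, mul_assoc]
  congr 1
  rw [ite_zero_mul_ite_zero, mul_one]
  congr 1
  refine propext ⟨fun H => ⟨fun t h₁ h₂ => H _ ?_ ?_, fun t ht => H t ?_ ?_⟩, fun H t h₁ h₂ => ?_⟩
  · simpa [window] using h₁
  · simp only [window]; omega
  · intro h₁
    exact ht ⟨j, by omega⟩ (Fin.ext h₁.symm)
  · intro h₁
    exact ht ⟨j + 1, hj⟩ (Fin.ext h₁.symm)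
  · by_cases ht : i ≤ t ∧ (t : ℕ) < i + n
    · have hw : window i h ⟨t - i, by omega⟩ = t := Fin.ext (by simp only [window]; omega)
      have := H.1 ⟨t - i, by omega⟩ (by simp only; omega) (by simp only; omega)
      simpa only [Function.comp_apply, hw] using this
    · refine H.2 t fun u hu => ht ?_
      have := congrArg Fin.val hu
      simp only [window] at this
      omega

theorem site_of_le {A : Type*} [Ring A] {N m i : ℕ} (h : m ≤ i + 1) (X : M2 N A) :
    site m i X = 1 := by
  ext a b
  simp [site, Matrix.one_apply, h.not_gt]

theorem site_commute {A : Type*} [CommRing A] {N m i j : ℕ} (hij : i + 2 ≤ j) (X Y : M2 N A) :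
    Commute (site m i X) (site m j Y) := by
  by_cases hj : j + 2 ≤ m
  · have hX := site_add (n := 2) (m := m) i 0 (by omega) (by omega) X
    have hY := site_add (n := 2) (m := m) j 0 hj (by omega) Y
    rw [add_zero] at hX hY
    rw [hX, hY]
    refine commute_place (window_injective _ _) (window_injective _ _) (fun t u h => ?_) _ _
    have := congrArg Fin.val h
    simp only [window] at this
    omega
  · rw [site_of_le (by omega) Y]
    exact Commute.one_right _

theorem YB.site_braid {A : Type*} [Ring A] {N m i : ℕ} {X : M2 N A} (hX : YB X)
    (hi : i + 2 < m) :
    site m i X * site m (i + 1) X * site m i X =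
      site m (i + 1) X * site m i X * site m (i + 1) X := by
  have h₀ := site_add (n := 3) (m := m) i 0 (by omega) (by omega) X
  rw [add_zero] at h₀
  rw [h₀, site_add (n := 3) (m := m) i 1 (by omega) (by omega) X]
  simp only [← place_mul (window_injective i _)]
  rw [hX]

theorem commute_chain {A : Type*} [CommRing A] {N m i j l : ℕ} {X : M2 N A}
    (h : j + 2 ≤ i ∨ i + l + 1 ≤ j) : Commute (chain m X i l) (site m j X) := by
  induction l with
  | zero => exact Commute.one_left _
  | succ l ih =>
    refine (ih (by omega)).mul_left ?_
    rcases h with h | h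
    · exact (site_commute (by omega) X X).symm
    · exact site_commute (by omega) X X

/-- `R̂_{i→i+l}` shifts the index of the operators `R̂_j` with `i ≤ j < i + l - 1` by one. -/
theorem YB.semiconjBy_chain {A : Type*} [CommRing A] {N m i j l : ℕ} {X : M2 N A} (hX : YB X)
    (hm : i + l < m) (hi : i ≤ j) (hj : j + 1 < i + l) :
    SemiconjBy (chain m X i l) (site m j X) (site m (j + 1) X) := by
  induction l with
  | zero => omega
  | succ l ih =>
    by_cases h : j + 1 < i + l
    · exact (ih (by omega) h).mul_left (site_commute (by omega) X X).symm
    · obtain ⟨l, rfl⟩ : ∃ l', l = l' + 1 := ⟨l - 1, by omega⟩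
      obtain rfl : j = i + l := by omega
      have hc : Commute (chain m X i l) (site m (i + l + 1) X) := commute_chain (by omega)
      calc chain m X i l * site m (i + l) X * site m (i + l + 1) X * site m (i + l) X
          = chain m X i l * (site m (i + l) X * site m (i + l + 1) X * site m (i + l) X) := by
            simp only [mul_assoc]
        _ = chain m X i l * site m (i + l + 1) X *
              (site m (i + l) X * site m (i + l + 1) X) := by
            rw [hX.site_braid (by omega)]
            simp only [mul_assoc]
        _ = site m (i + l + 1) X *
              (chain m X i l * site m (i + l) X * site m (i + l + 1) X) := by
            rw [hc.eq]
            simp only [mul_assoc]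

theorem YB.semiconjBy_chain_mul_chain {A : Type*} [CommRing A] {N m i l : ℕ} {X : M2 N A}
    (hX : YB X) (hm : i + l + 1 < m) :
    SemiconjBy (chain m X (i + 1) l * chain m X i l) (site m (i + l) X) (site m i X) := by
  induction l with
  | zero => simp [chain]
  | succ l ih =>
    have hc : Commute (chain m X i l) (site m (i + l + 1) X) := commute_chain (by omega)
    have hb : SemiconjBy (site m (i + l + 1) X * site m (i + l) X) (site m (i + l + 1) X)
        (site m (i + l) X) := by
      rw [SemiconjBy, ← hX.site_braid (by omega), mul_assoc]
    have he : chain m X (i + 1) (l + 1) * chain m X i (l + 1) =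
        chain m X (i + 1) l * chain m X i l * (site m (i + l + 1) X * site m (i + l) X) := by
      simp only [chain, add_right_comm i 1 l, mul_assoc]
      rw [← mul_assoc (site m (i + l + 1) X), ← hc.eq, mul_assoc]
    rw [he]
    exact (ih (by omega)).mul_left hb

theorem commute_Ustack {A : Type*} [CommRing A] {N m j k l : ℕ} {X : M2 N A}
    (h : k + l ≤ j) : Commute (Ustack m X k l) (site m j X) := by
  induction l with
  | zero => exact Commute.one_left _
  | succ l ih => exact (commute_chain (by omega)).mul_left (ih (by omega))

theorem YB.semiconjBy_Ustack_left {A : Type*} [CommRing A] {N m j k l : ℕ} {X : M2 N A}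
    (hX : YB X) (hm : k + l ≤ m) (hj : j + 1 < k) :
    SemiconjBy (Ustack m X k l) (site m j X) (site m (l + j) X) := by
  induction l with
  | zero => simp [Ustack]
  | succ l ih =>
    rw [add_right_comm l 1 j]
    exact (hX.semiconjBy_chain (by omega) (by omega) (by omega)).mul_left (ih (by omega))

theorem YB.semiconjBy_Ustack_right {A : Type*} [CommRing A] {N m j k l : ℕ} {X : M2 N A}
    (hX : YB X) (hm : k + l ≤ m) (hj : j + 1 < l) :
    SemiconjBy (Ustack m X k l) (site m (k + j) X) (site m j X) := by
  induction l with
  | zero => omega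
  | succ l ih =>
    by_cases h : j + 1 < l
    · exact SemiconjBy.mul_left (commute_chain (by omega)) (ih (by omega) h)
    · obtain rfl : l = j + 1 := by omega
      have hc := hX.semiconjBy_chain_mul_chain (m := m) (i := j) (l := k) (by omega)
      rw [add_comm j k] at hc
      simpa only [Ustack, mul_assoc] using hc.mul_left (commute_Ustack le_rfl)

theorem semiconjBy_evalY {K : Type*} [Field K] {A : Type*} [Ring A] [Algebra K A] {N m v : ℕ}
    {R : M2 N A} {p q : ℕ} {U : Op N A m}
    (h : ∀ j < v, SemiconjBy U (site m (p + j) R) (site m (q + j) R))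
    (Y : FreeAlgebra K (Fin v)) : SemiconjBy U (evalY R p Y) (evalY R q Y) := by
  unfold evalY
  induction Y using FreeAlgebra.induction with
  | grade0 r =>
    simp only [AlgHom.commutes]
    exact Algebra.commute_algebraMap_right r U
  | grade1 x => simpa only [FreeAlgebra.lift_ι_apply] using h x x.isLt
  | mul a b ha hb => simpa only [map_mul] using ha.mul_right hb
  | add a b ha hb => simpa only [map_add] using ha.add_right hb

/-- (20).  Let `R̂` be an invertible solution of the Yang–Baxter
equation, and let `U = R̂_{i→i+k−1} ⋯ R̂_{2→k+1} R̂_{1→k}` (here `k = k0+1`,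
`i = i0+1`, so `U = Ustack (k+i) R̂ k i`).  Then for any polynomials `Y^{(k)}` in
`R̂₁,…,R̂_{k−1}` and `Z^{(i)}` in `R̂₁,…,R̂_{i−1}`,
`U Y^{(k)}(R̂₁,…,R̂_{k−1}) = Y^{(k)}(R̂_{i+1},…,R̂_{i+k−1}) U` and
`U Z^{(i)}(R̂_{k+1},…,R̂_{k+i−1}) = Z^{(i)}(R̂₁,…,R̂_{i−1}) U`
as operators on `V^{⊗(k+i)}`. -/
theorem Ustack_conjugation {K : Type} [Field K] {N : ℕ}
    (R : M2 N K) (hR : IsUnit R) (hYB : YB R) :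
    ∀ (k0 i0 : ℕ) (Y : FreeAlgebra K (Fin k0)) (Z : FreeAlgebra K (Fin i0)),
      Ustack (k0 + 1 + (i0 + 1)) R (k0 + 1) (i0 + 1) *
          evalY (m := k0 + 1 + (i0 + 1)) R 0 Y =
        evalY R (i0 + 1) Y * Ustack (k0 + 1 + (i0 + 1)) R (k0 + 1) (i0 + 1) ∧
      Ustack (k0 + 1 + (i0 + 1)) R (k0 + 1) (i0 + 1) *
          evalY (m := k0 + 1 + (i0 + 1)) R (k0 + 1) Z =
        evalY R 0 Z * Ustack (k0 + 1 + (i0 + 1)) R (k0 + 1) (i0 + 1) := by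
  intro k0 i0 Y Z
  refine ⟨semiconjBy_evalY (fun j hj => ?_) Y, semiconjBy_evalY (fun j hj => ?_) Z⟩
  · rw [zero_add]
    exact hYB.semiconjBy_Ustack_left le_rfl (by omega)
  · rw [zero_add]
    exact hYB.semiconjBy_Ustack_right le_rfl (by omega)

end CHN
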